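/- Let n ≥ 1 and p ≥ 1 be natural numbers and q an integer. In the quaternion algebra H_ℚ(−1, p), the norm of the n-th generalized Fibonacci-Lucas quaternion G_n^{p,q} satisfies n(G_n^{p,q}) = (p³ + p² + 8p²q + 15pq² + 2pq)·f_{2n−1} + (−3p³ + 5q² − 22p²q − 40pq² + 2pq)·f_{2n+1}. -/

import Mathlib

open scoped Quaternion

/-- The Lucas sequence: `l 0 = 2`, `l 1 = 1`, `l (n+2) = l (n+1) + l n`. -/
def lucas : ℕ → ℕ
  | 0 => 2
  | 1 => 1
  | n + 2 => lucas (n + 1) + lucas n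

/-- The generalized Fibonacci-Lucas numbers `g n ^ {p,q} = p * f (n-1) + q * l n` (for `n ≥ 1`). -/
def g (p q : ℤ) (n : ℕ) : ℤ := p * Nat.fib (n - 1) + q * lucas n

/-- The `n`-th generalized Fibonacci-Lucas quaternion
`G_n^{p,q} = g_n^{p,q} + g_{n+1}^{p,q} i + g_{n+2}^{p,q} j + g_{n+3}^{p,q} k` in `ℍ[ℚ, α, β]`. -/
def G (α β : ℚ) (p q : ℤ) (n : ℕ) : ℍ[ℚ, α, β] :=
  ⟨(g p q n : ℚ), (g p q (n + 1) : ℚ), (g p q (n + 2) : ℚ), (g p q (n + 3) : ℚ)⟩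

/-- The norm of a generalized quaternion:
`n(a) = a₁² - α a₂² - β a₃² + α β a₄²`. -/
def qnorm (α β : ℚ) (a : ℍ[ℚ, α, β]) : ℚ :=
  a.re ^ 2 - α * a.imI ^ 2 - β * a.imJ ^ 2 + α * β * a.imK ^ 2

theorem lucas_succ_fib (m : ℕ) : lucas (m + 1) = 2 * Nat.fib m + Nat.fib (m + 1) ∧
    lucas (m + 2) = Nat.fib m + 3 * Nat.fib (m + 1) := by
  induction m with
  | zero => simp [lucas]
  | succ k ih =>
    obtain ⟨h1, h2⟩ := ih
    have h3 : lucas (k + 1 + 2) = lucas (k + 2) + lucas (k + 1) := rfl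
    have h4 : Nat.fib (k + 1 + 1) = Nat.fib k + Nat.fib (k + 1) := Nat.fib_add_two
    have h5 : lucas (k + 1 + 1) = lucas (k + 2) := rfl
    omega

theorem norm_gen_fib_lucas_quaternion (n p : ℕ) (hn : 1 ≤ n) (hp : 1 ≤ p) (q : ℤ) :
    qnorm (-1) (p : ℚ) (G (-1) (p : ℚ) (p : ℤ) q n) =
      (((p : ℤ) ^ 3 + (p : ℤ) ^ 2 + 8 * (p : ℤ) ^ 2 * q + 15 * (p : ℤ) * q ^ 2 +
          2 * (p : ℤ) * q : ℤ) : ℚ) * (Nat.fib (2 * n - 1) : ℚ) +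
      ((-3 * (p : ℤ) ^ 3 + 5 * q ^ 2 - 22 * (p : ℤ) ^ 2 * q - 40 * (p : ℤ) * q ^ 2 +
          2 * (p : ℤ) * q : ℤ) : ℚ) * (Nat.fib (2 * n + 1) : ℚ) := by
  obtain ⟨m, rfl⟩ : ∃ m, n = m + 1 := ⟨n - 1, by omega⟩
  obtain ⟨h1, h2⟩ := lucas_succ_fib m
  have h3 : lucas (m + 3) = lucas (m + 2) + lucas (m + 1) := rfl
  have h4 : lucas (m + 4) = lucas (m + 3) + lucas (m + 2) := rfl
  have f2 : Nat.fib (m + 2) = Nat.fib m + Nat.fib (m + 1) := Nat.fib_add_two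
  have f3 : Nat.fib (m + 3) = Nat.fib (m + 1) + Nat.fib (m + 2) := Nat.fib_add_two
  have e1 : Nat.fib (2 * (m + 1) - 1) = Nat.fib (m + 1) ^ 2 + Nat.fib m ^ 2 := by
    rw [← Nat.fib_two_mul_add_one]; rfl
  have e2 : Nat.fib (2 * (m + 1) + 1) = Nat.fib (m + 2) ^ 2 + Nat.fib (m + 1) ^ 2 :=
    Nat.fib_two_mul_add_one (m + 1)
  have g1 : g p q (m + 1) = p * Nat.fib m + q * lucas (m + 1) := rfl
  have g2 : g p q (m + 1 + 1) = p * Nat.fib (m + 1) + q * lucas (m + 2) := rfl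
  have g3 : g p q (m + 1 + 2) = p * Nat.fib (m + 2) + q * lucas (m + 3) := rfl
  have g4 : g p q (m + 1 + 3) = p * Nat.fib (m + 3) + q * lucas (m + 4) := rfl
  simp only [qnorm, G]
  rw [g1, g2, g3, g4, e1, e2, h4, h3, h2, h1, f3, f2]
  push_cast
  ring
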